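/- Let S ⊆ ℝⁿ be a nonempty closed set and r > 0. Then S is r-prox-regular if and only if on U_r := {x ∈ ℝⁿ : d_S(x) < r} the squared distance function d_S² is differentiable with locally Lipschitz gradient, and ∇d_S²(x) = 2(x − Π_S(x)) for all x ∈ U_r (in particular Π_S is single-valued on U_r). -/

import Mathlib

open Metric Set

noncomputable section

abbrev Euc (n : ℕ) := EuclideanSpace ℝ (Fin n)

/-- The metric projection `Π_S(x) = {y ∈ S : |x − y| = d_S(x)}`. -/
def projSet {n : ℕ} (S : Set (Euc n)) (x : Euc n) : Set (Euc n) :=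
  {y ∈ S | dist x y = Metric.infDist x S}

/-- The proximal normal cone `N^P_S(xbar) = {η : ∃ σ > 0, xbar ∈ Π_S(xbar + σ η)}`. -/
def proxNormalCone {n : ℕ} (S : Set (Euc n)) (xbar : Euc n) : Set (Euc n) :=
  {η | ∃ σ > (0 : ℝ), xbar ∈ projSet S (xbar + σ • η)}

/-- `S` is `r`-prox-regular. -/
def IsProxRegular {n : ℕ} (r : ℝ) (S : Set (Euc n)) : Prop :=
  ∀ xbar ∈ S, ∀ η ∈ proxNormalCone S xbar, ‖η‖ = 1 →
    ∀ s : ℝ, 0 < s → s ≤ r → xbar ∈ projSet S (xbar + s • η)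

/-- `g` is locally Lipschitz on `U`. -/
def LocallyLipschitzOnSet {n : ℕ} (U : Set (Euc n)) (g : Euc n → Euc n) : Prop :=
  ∀ x ∈ U, ∃ (K : NNReal) (t : Set (Euc n)), t ∈ nhdsWithin x U ∧ LipschitzOnWith K g t

lemma mem_projSet_iff {n : ℕ} {S : Set (Euc n)} {x y : Euc n} :
    y ∈ projSet S x ↔ y ∈ S ∧ ∀ z ∈ S, ‖x - y‖ ≤ ‖x - z‖ := by
  constructor
  · rintro ⟨h1, h2⟩
    refine ⟨h1, fun z hz => ?_⟩
    rw [← dist_eq_norm, ← dist_eq_norm, h2]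
    exact Metric.infDist_le_dist_of_mem hz
  · rintro ⟨h1, h2⟩
    refine ⟨h1, le_antisymm ?_ (Metric.infDist_le_dist_of_mem h1)⟩
    refine (Metric.le_infDist ⟨y, h1⟩).2 fun {z} hz => ?_
    rw [dist_eq_norm, dist_eq_norm]
    exact h2 z hz

lemma projSet_segment {n : ℕ} {S : Set (Euc n)} {p v : Euc n} {t : ℝ}
    (h : p ∈ projSet S (p + v)) (h0 : 0 ≤ t) (h1 : t ≤ 1) : p ∈ projSet S (p + t • v) := by
  rw [mem_projSet_iff] at h ⊢
  refine ⟨h.1, fun z hz => ?_⟩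
  have h2 := h.2 z hz
  have h3 : ‖p + v - z‖ ≤ ‖p + t • v - z‖ + ‖(1 - t) • v‖ := by
    have : p + v - z = (p + t • v - z) + (1 - t) • v := by module
    rw [this]; exact norm_add_le _ _
  rw [norm_smul, Real.norm_of_nonneg (by linarith)] at h3
  rw [add_sub_cancel_left] at h2 ⊢
  rw [norm_smul, Real.norm_of_nonneg h0]
  linarith

lemma projSet_nonempty {n : ℕ} {S : Set (Euc n)} (hne : S.Nonempty) (hcl : IsClosed S)
    (x : Euc n) : (projSet S x).Nonempty := by
  obtain ⟨y, hy, h⟩ := hcl.exists_infDist_eq_dist hne x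
  exact ⟨y, hy, h.symm⟩

lemma prox_ineq {n : ℕ} {S : Set (Euc n)} {r : ℝ} (hr : 0 < r) (hS : IsProxRegular r S)
    {x p y : Euc n} (hp : p ∈ projSet S x) (hy : y ∈ S) :
    2 * r * inner ℝ (x - p) (y - p) ≤ Metric.infDist x S * ‖y - p‖ ^ 2 := by
  have hd : ‖x - p‖ = Metric.infDist x S := by rw [← dist_eq_norm]; exact hp.2
  rw [← hd]
  by_cases h0 : x - p = 0
  · simp [h0]
  have hpos : 0 < ‖x - p‖ := norm_pos_iff.2 h0
  set d := ‖x - p‖ with hdd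
  have key := hS p hp.1 (d⁻¹ • (x - p)) ⟨d, hpos, by
    rw [smul_smul, mul_inv_cancel₀ hpos.ne', one_smul, add_sub_cancel]; exact hp⟩
    (by rw [norm_smul, norm_inv, norm_norm, ← hdd, inv_mul_cancel₀ hpos.ne']) r hr le_rfl
  rw [mem_projSet_iff] at key
  have k := key.2 y hy
  have e : p + r • d⁻¹ • (x - p) - y = r • d⁻¹ • (x - p) - (y - p) := by abel
  rw [add_sub_cancel_left, e] at k
  have k2 := pow_le_pow_left₀ (norm_nonneg _) k 2
  rw [norm_sub_sq_real, inner_smul_left, inner_smul_left] at k2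
  simp only [conj_trivial] at k2
  have k3 : 2 * r * (d⁻¹ * inner ℝ (x - p) (y - p)) ≤ ‖y - p‖ ^ 2 := by linarith
  calc 2 * r * inner ℝ (x - p) (y - p) = d * (2 * r * (d⁻¹ * inner ℝ (x - p) (y - p))) := by
        field_simp
    _ ≤ _ := mul_le_mul_of_nonneg_left k3 hpos.le

lemma prox_lip {n : ℕ} {S : Set (Euc n)} {r ρ : ℝ} (hr : 0 < r) (hS : IsProxRegular r S)
    {x p x' p' : Euc n} (hp : p ∈ projSet S x) (hp' : p' ∈ projSet S x')
    (h : Metric.infDist x S ≤ ρ) (h' : Metric.infDist x' S ≤ ρ) (hρ : ρ < r) :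
    ‖p - p'‖ ≤ r / (r - ρ) * ‖x - x'‖ := by
  have a := prox_ineq hr hS hp hp'.1
  have b := prox_ineq hr hS hp' hp.1
  rw [norm_sub_rev p' p] at a
  have c : inner ℝ (x - p) (p' - p) + inner ℝ (x' - p') (p - p')
      = ‖p - p'‖ ^ 2 - inner ℝ (x - x') (p - p') := by
    rw [← real_inner_self_eq_norm_sq, ← neg_sub p p', inner_neg_right, neg_add_eq_sub,
      ← inner_sub_left, ← inner_sub_left]
    congr 1; abel
  have cs := real_inner_le_norm (x - x') (p - p')
  have hq : 0 ≤ ‖p - p'‖ ^ 2 := by positivity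
  have m1 := mul_le_mul_of_nonneg_right h hq
  have m2 := mul_le_mul_of_nonneg_right h' hq
  have m3 : (r - ρ) * ‖p - p'‖ ^ 2 ≤ r * (‖x - x'‖ * ‖p - p'‖) := by
    have := mul_le_mul_of_nonneg_left cs hr.le
    nlinarith
  rw [div_mul_eq_mul_div, le_div_iff₀ (by linarith)]
  rcases (norm_nonneg (p - p')).eq_or_lt with h0 | h0
  · rw [← h0, zero_mul]; positivity
  · refine le_of_mul_le_mul_right ?_ h0
    linarith

lemma dist_sq_upper {n : ℕ} {S : Set (Euc n)} {x p : Euc n} (hp : p ∈ projSet S x) (y : Euc n) :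
    Metric.infDist y S ^ 2 ≤
      Metric.infDist x S ^ 2 + 2 * inner ℝ (x - p) (y - x) + ‖y - x‖ ^ 2 := by
  have hd : ‖x - p‖ = Metric.infDist x S := by rw [← dist_eq_norm]; exact hp.2
  rw [← hd, ← norm_add_sq_real]
  have : x - p + (y - x) = y - p := by abel
  rw [this, ← dist_eq_norm]
  exact pow_le_pow_left₀ Metric.infDist_nonneg (Metric.infDist_le_dist_of_mem hp.1) 2

lemma prox_forward {n : ℕ} (S : Set (Euc n)) (hne : S.Nonempty) (hcl : IsClosed S)
    (r : ℝ) (hr : 0 < r) (hS : IsProxRegular r S) :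
      ∃ π : Euc n → Euc n,
        (∀ x : Euc n, Metric.infDist x S < r → projSet S x = {π x}) ∧
        (∀ x : Euc n, Metric.infDist x S < r →
          HasGradientAt (fun y => Metric.infDist y S ^ 2) ((2 : ℝ) • (x - π x)) x) ∧
        LocallyLipschitzOnSet {x : Euc n | Metric.infDist x S < r}
          (fun x => (2 : ℝ) • (x - π x)) := by
  choose π hπ using projSet_nonempty hne hcl
  have loc : ∀ x : Euc n, Metric.infDist x S < r → ∃ C : ℝ, 0 ≤ C ∧ ∃ t ∈ nhds x,
      x ∈ t ∧ ∀ y ∈ t, ∀ z ∈ t, ‖π y - π z‖ ≤ C * ‖y - z‖ := by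
    intro x hx
    have h1 : Metric.infDist x S < (Metric.infDist x S + r) / 2 := by linarith
    refine ⟨r / (r - (Metric.infDist x S + r) / 2), div_nonneg hr.le (by linarith),
      {y | Metric.infDist y S < (Metric.infDist x S + r) / 2},
      (isOpen_lt (Metric.continuous_infDist_pt S) continuous_const).mem_nhds h1, h1, ?_⟩
    intro y hy z hz
    exact prox_lip hr hS (hπ y) (hπ z) (le_of_lt hy) (le_of_lt hz) (by linarith)
  refine ⟨π, ?_, ?_, ?_⟩
  · intro x hx
    refine Set.eq_singleton_iff_unique_mem.2 ⟨hπ x, fun p hp => ?_⟩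
    have := prox_lip hr hS hp (hπ x) le_rfl le_rfl hx
    rw [sub_self, norm_zero, mul_zero] at this
    exact sub_eq_zero.1 (norm_le_zero_iff.1 this)
  · intro x hx
    obtain ⟨C, hC, t, ht, hxt, hL⟩ := loc x hx
    rw [hasGradientAt_iff_isLittleO]
    refine Asymptotics.IsBigO.trans_isLittleO (g := fun y => ‖y - x‖ ^ 2) ?_ ?_
    · refine Asymptotics.IsBigO.of_bound (1 + 2 * C) ?_
      filter_upwards [ht] with y hy
      have u := dist_sq_upper (hπ x) y
      have l := dist_sq_upper (hπ y) x
      have c := hL y hy x hxt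
      have cs := real_inner_le_norm (π y - π x) (y - x)
      have cs2 := mul_le_mul_of_nonneg_right c (norm_nonneg (y - x))
      have e : inner ℝ (y - π y) (x - y) = - inner ℝ (x - π x) (y - x) - ‖y - x‖ ^ 2
          + inner ℝ (π y - π x) (y - x) := by
        rw [← real_inner_self_eq_norm_sq, ← neg_sub y x, inner_neg_right]
        have : y - π y = (x - π x) + (y - x) - (π y - π x) := by abel
        rw [this, inner_sub_left, inner_add_left]
        ring
      rw [norm_sub_rev x y] at l
      have hq : 0 ≤ C * ‖y - x‖ ^ 2 := by positivity
      rw [inner_smul_left, Real.norm_of_nonneg (sq_nonneg ‖y - x‖), Real.norm_eq_abs, abs_le]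
      simp only [conj_trivial]
      constructor <;> nlinarith
    · refine Asymptotics.isLittleO_norm_left.1 ?_
      simpa using Asymptotics.isLittleO_pow_sub_sub x (m := 2) (by norm_num)
  · intro x hx
    obtain ⟨C, hC, t, ht, hxt, hL⟩ := loc x hx
    refine ⟨⟨2 * (1 + C), by positivity⟩, t, mem_nhdsWithin_of_mem_nhds ht, ?_⟩
    refine LipschitzOnWith.of_dist_le_mul fun y hy z hz => ?_
    have := hL y hy z hz
    rw [dist_eq_norm, dist_eq_norm, ← smul_sub, norm_smul]
    have e : y - π y - (z - π z) = (y - z) - (π y - π z) := by abel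
    have := norm_sub_le (y - z) (π y - π z)
    rw [e, Real.norm_of_nonneg (by norm_num)]
    change 2 * _ ≤ 2 * (1 + C) * ‖y - z‖
    linarith

lemma prox_extend {n : ℕ} {S : Set (Euc n)} {r : ℝ} {π : Euc n → Euc n}
    (h1 : ∀ x : Euc n, Metric.infDist x S < r → projSet S x = {π x})
    (h3 : LocallyLipschitzOnSet {x : Euc n | Metric.infDist x S < r}
          (fun x => (2 : ℝ) • (x - π x)))
    {p v : Euc n} (hp : p ∈ projSet S (p + v)) (hv : ‖v‖ < r) :
    ∃ ε > (0 : ℝ), ∀ t : ℝ, 0 < t → t < ε → p ∈ projSet S (p + (1 - t)⁻¹ • v) := by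
  have hr : 0 < r := (norm_nonneg v).trans_lt hv
  set x := p + v with hx
  have hxd : Metric.infDist x S < r := by
    rw [← hp.2, dist_eq_norm, hx, add_sub_cancel_left]; exact hv
  have hop : IsOpen {x : Euc n | Metric.infDist x S < r} :=
    isOpen_lt (Metric.continuous_infDist_pt S) continuous_const
  obtain ⟨K, T, hT, hL⟩ := h3 x hxd
  rw [hop.nhdsWithin_eq hxd] at hT
  obtain ⟨ρ, hρ, hball⟩ := Metric.nhds_basis_closedBall.mem_iff.1
    (Filter.inter_mem hT (hop.mem_nhds hxd))
  refine ⟨min (1 / 2) (min (ρ / r) (1 / (K + 1))), by positivity, ?_⟩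
  intro t ht htε
  have ht1 : t < 1 / 2 := htε.trans_le (min_le_left _ _)
  have ht2 : t < ρ / r := htε.trans_le ((min_le_right _ _).trans (min_le_left _ _))
  have ht3 : t < 1 / (K + 1) := htε.trans_le ((min_le_right _ _).trans (min_le_right _ _))
  rw [lt_div_iff₀ hr] at ht2
  rw [lt_div_iff₀ (by positivity)] at ht3
  have hmaps : MapsTo (fun z => x + t • (z - π z)) (closedBall x ρ) (closedBall x ρ) := by
    intro z hz
    have hzd : Metric.infDist z S < r := (hball hz).2
    have hpz : π z ∈ projSet S z := by rw [h1 z hzd]; rfl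
    rw [mem_closedBall, dist_eq_norm, add_sub_cancel_left, norm_smul, Real.norm_of_nonneg ht.le,
      ← dist_eq_norm, hpz.2]
    nlinarith
  have hcontr : ContractingWith (1 / 2) (hmaps.restrict _ _ _) := by
    refine ⟨by
      rw [← NNReal.coe_lt_coe]; norm_num, LipschitzWith.of_dist_le_mul ?_⟩
    rintro ⟨y, hy⟩ ⟨z, hz⟩
    have := hL.dist_le_mul y (hball hy).1 z (hball hz).1
    rw [Subtype.dist_eq, Subtype.dist_eq]
    simp only [MapsTo.val_restrict_apply]
    rw [dist_add_left, dist_smul₀, Real.norm_of_nonneg ht.le]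
    rw [dist_smul₀, Real.norm_of_nonneg (by norm_num)] at this
    have hd : 0 ≤ dist y z := dist_nonneg
    have m := mul_le_mul_of_nonneg_left this ht.le
    have : t * K * dist y z ≤ 1 * dist y z := mul_le_mul_of_nonneg_right (by nlinarith) hd
    push_cast
    nlinarith
  obtain ⟨z, hz, hfix, -⟩ := hcontr.exists_fixedPoint' isClosed_closedBall.isComplete hmaps
    (mem_closedBall_self hρ.le) (edist_ne_top _ _)
  have hfix' : x + t • (z - π z) = z := hfix
  have hzd : Metric.infDist z S < r := (hball hz).2
  have hpz : π z ∈ projSet S z := by rw [h1 z hzd]; rfl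
  have hxe : x = π z + (1 - t) • (z - π z) := by
    have : x = z - t • (z - π z) := eq_sub_of_add_eq hfix'
    rw [this]; module
  have hpx : π z ∈ projSet S x := by
    rw [hxe]
    refine projSet_segment ?_ (by linarith) (by linarith)
    rw [add_sub_cancel]; exact hpz
  have hpe : π z = p := by
    rw [h1 x hxd] at hp hpx
    rw [Set.mem_singleton_iff.1 hp, Set.mem_singleton_iff.1 hpx]
  have hve : v = (1 - t) • (z - p) := by
    rw [hpe, hx] at hxe
    exact add_left_cancel hxe
  rw [hve, smul_smul, inv_mul_cancel₀ (by linarith), one_smul, add_sub_cancel, ← hpe]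
  exact hpz

lemma prox_backward {n : ℕ} {S : Set (Euc n)} {r : ℝ} (hr : 0 < r) {π : Euc n → Euc n}
    (h1 : ∀ x : Euc n, Metric.infDist x S < r → projSet S x = {π x})
    (h3 : LocallyLipschitzOnSet {x : Euc n | Metric.infDist x S < r}
          (fun x => (2 : ℝ) • (x - π x))) : IsProxRegular r S := by
  intro p hpS η hη hη1 s hs hsr
  obtain ⟨σ, hσ, hp⟩ := hη
  have mono : ∀ a b : ℝ, 0 ≤ a → a ≤ b → 0 < b → p ∈ projSet S (p + b • η) →
      p ∈ projSet S (p + a • η) := by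
    intro a b ha hab hb h
    have := projSet_segment h (div_nonneg ha hb.le) ((div_le_one hb).2 hab)
    rwa [smul_smul, div_mul_cancel₀ _ hb.ne'] at this
  let A : Set ℝ := Icc 0 r ∩ {s | dist (p + s • η) p = Metric.infDist (p + s • η) S}
  have hA : IsCompact A := by
    refine isCompact_Icc.inter_right (isClosed_eq (by fun_prop) ?_)
    exact (Metric.continuous_infDist_pt S).comp (by fun_prop)
  have hm : min σ r ∈ A := by
    have hpos : 0 < min σ r := lt_min hσ hr
    exact ⟨⟨hpos.le, min_le_right _ _⟩, (mono _ _ hpos.le (min_le_left _ _) hσ hp).2⟩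
  obtain ⟨m, hmA, hmax⟩ := hA.exists_isGreatest ⟨_, hm⟩
  have hm0 : 0 < m := (lt_min hσ hr).trans_le (hmax hm)
  have hmr : m = r := by
    by_contra hne
    have hlt : m < r := lt_of_le_of_ne hmA.1.2 hne
    obtain ⟨ε, hε, H⟩ := prox_extend h1 h3 (p := p) (v := m • η) ⟨hpS, hmA.2⟩
      (by rw [norm_smul, hη1, mul_one, Real.norm_of_nonneg hm0.le]; exact hlt)
    have hq : 0 < 1 - m / r := by rw [sub_pos, div_lt_one hr]; exact hlt
    obtain ⟨t, ht0, ht⟩ := exists_between (lt_min hε hq)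
    have ht1 := ht.trans_le (min_le_left _ _)
    have ht2 := ht.trans_le (min_le_right _ _)
    have hmr0 : 0 < m / r := div_pos hm0 hr
    have h1t : 0 < 1 - t := by linarith
    have hk := H t ht0 ht1
    rw [smul_smul] at hk
    have hle : (1 - t)⁻¹ * m ≤ r := by
      rw [inv_mul_le_iff₀ h1t]
      have : m / r < 1 - t := by linarith
      rw [div_lt_iff₀ hr] at this
      exact this.le
    have := hmax (show (1 - t)⁻¹ * m ∈ A from ⟨⟨by positivity, hle⟩, hk.2⟩)
    rw [inv_mul_le_iff₀ h1t] at this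
    nlinarith
  exact mono s m hs.le (by linarith) hm0 ⟨hpS, hmA.2⟩

/-- Proposition 2.3 (i)⇔(v): `S` is `r`-prox-regular iff on
`U_r = {x : d_S(x) < r}` the projection is single-valued (say `Π_S(x) = {π x}`), the
squared distance `d_S²` is differentiable with gradient `∇d_S²(x) = 2(x − π x)`,
and this gradient is locally Lipschitz on `U_r`. -/
theorem stmt8 {n : ℕ} (S : Set (Euc n)) (hne : S.Nonempty) (hcl : IsClosed S)
    (r : ℝ) (hr : 0 < r) :
    IsProxRegular r S ↔
      ∃ π : Euc n → Euc n,
        (∀ x : Euc n, Metric.infDist x S < r → projSet S x = {π x}) ∧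
        (∀ x : Euc n, Metric.infDist x S < r →
          HasGradientAt (fun y => Metric.infDist y S ^ 2) ((2 : ℝ) • (x - π x)) x) ∧
        LocallyLipschitzOnSet {x : Euc n | Metric.infDist x S < r}
          (fun x => (2 : ℝ) • (x - π x)) := by
  constructor
  · exact prox_forward S hne hcl r hr
  · rintro ⟨π, h1, -, h3⟩
    exact prox_backward hr h1 h3
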